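/- For all integers n, r, t with n ≥ 0, r ≥ 2 and 1 ≤ t ≤ r−1, E_{0,r,t}(n) = |O_{1,r}(n)| = |D_{1,r}(n)|. -/

import Mathlib

open Finset

/-- The number of parts of a partition. -/
def numParts {n : ℕ} (p : Nat.Partition n) : ℕ := Multiset.card p.parts

/-- The number of different parts of a partition. -/
def numDistinctParts {n : ℕ} (p : Nat.Partition n) : ℕ := p.parts.toFinset.card

/-- `O_{j,r}(n)`: partitions of `n` with exactly `j` different parts divisible by `r`. -/
def setO (j r n : ℕ) : Finset (Nat.Partition n) :=
  Finset.univ.filter fun p => (p.parts.toFinset.filter fun i => r ∣ i).card = j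

/-- `D_{j,r}(n)`: partitions of `n` with exactly `j` different parts repeated at least `r`
times (all other parts appearing at most `r - 1` times). -/
def setD (j r n : ℕ) : Finset (Nat.Partition n) :=
  Finset.univ.filter fun p => (p.parts.toFinset.filter fun i => r ≤ p.parts.count i).card = j

/-- `O_{≤j,r}(n)`: partitions of `n` with at most `j` different parts divisible by `r`. -/
def setOle (j r n : ℕ) : Finset (Nat.Partition n) :=
  Finset.univ.filter fun p => (p.parts.toFinset.filter fun i => r ∣ i).card ≤ j

/-- `D_{≤j,r}(n)`: partitions of `n` with at most `j` different parts repeated at least `r`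
times (all other parts appearing at most `r - 1` times). -/
def setDle (j r n : ℕ) : Finset (Nat.Partition n) :=
  Finset.univ.filter fun p => (p.parts.toFinset.filter fun i => r ≤ p.parts.count i).card ≤ j

/-- `ℓ_t(λ)`: the number of parts of `λ` congruent to `t` modulo `r`, counted with
multiplicity. -/
def ellMod {n : ℕ} (r t : ℕ) (p : Nat.Partition n) : ℕ :=
  Multiset.card (p.parts.filter fun i => i % r = t)

/-- `ℓ̄_t(λ)`: the number of different parts of `λ` whose residual multiplicity
(multiplicity mod `r`) is at least `t`. -/
def ellBarMod {n : ℕ} (r t : ℕ) (p : Nat.Partition n) : ℕ :=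
  (p.parts.toFinset.filter fun i => t ≤ p.parts.count i % r).card

/-- `b_{j,r}(n)`: the difference between the number of parts in all partitions in
`O_{j,r}(n)` and the number of parts in all partitions in `D_{j,r}(n)`. -/
def bDiff (j r n : ℕ) : ℤ :=
  (∑ p ∈ setO j r n, (numParts p : ℤ)) - ∑ p ∈ setD j r n, (numParts p : ℤ)

/-- `b_{≤j,r}(n)`. -/
def bDiffLe (j r n : ℕ) : ℤ :=
  (∑ p ∈ setOle j r n, (numParts p : ℤ)) - ∑ p ∈ setDle j r n, (numParts p : ℤ)

/-- `E_{j,r,t}(n)`. -/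
def EDiff (j r t n : ℕ) : ℤ :=
  (∑ p ∈ setO j r n, ((ellMod r t p : ℤ) - (ellMod r 0 p : ℤ))) -
    ∑ p ∈ setD j r n, (ellBarMod r t p : ℤ)

/-- `b'_{j,r}(n)`: the difference between the number of different parts in all partitions in
`D_{j,r}(n)` and the number of different parts in all partitions in `O_{j,r}(n)`. -/
def bDiff' (j r n : ℕ) : ℤ :=
  (∑ p ∈ setD j r n, (numDistinctParts p : ℤ)) - ∑ p ∈ setO j r n, (numDistinctParts p : ℤ)

/-- `b'_{≤j,r}(n)`. -/
def bDiffLe' (j r n : ℕ) : ℤ :=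
  (∑ p ∈ setDle j r n, (numDistinctParts p : ℤ)) - ∑ p ∈ setOle j r n, (numDistinctParts p : ℤ)

/-- `T_{j,r}(n)`: the number of different parts with multiplicity between `r + 1` and
`2r - 1` in all partitions in `D_{j,r}(n)`. -/
def Tcount (j r n : ℕ) : ℕ :=
  ∑ p ∈ setD j r n,
    (p.parts.toFinset.filter fun i =>
      r + 1 ≤ p.parts.count i ∧ p.parts.count i ≤ 2 * r - 1).card

open Classical in
/-- Partitions of `n` whose multiset of parts satisfies `P`. -/
noncomputable def setP (P : Multiset ℕ → Prop) (n : ℕ) : Finset (Nat.Partition n) :=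
  Finset.univ.filter fun p => P p.parts

theorem mem_setP {P : Multiset ℕ → Prop} {n : ℕ} {p : Nat.Partition n} :
    p ∈ setP P n ↔ P p.parts := by
  simp [setP]

/-- Number of partitions of `n` whose multiset of parts satisfies `P`. -/
noncomputable def cntP (P : Multiset ℕ → Prop) (n : ℕ) : ℕ := (setP P n).card

/-- `cntP P (n - m)`, or zero if `m > n`. -/
noncomputable def cntS (P : Multiset ℕ → Prop) (n m : ℕ) : ℕ :=
  if m ≤ n then cntP P (n - m) else 0

theorem cntP_congr {P Q : Multiset ℕ → Prop} {n : ℕ}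
    (h : ∀ p : Nat.Partition n, P p.parts ↔ Q p.parts) : cntP P n = cntP Q n := by
  classical
  unfold cntP
  congr 1
  ext p
  simp [mem_setP, h p]

theorem part_le {n : ℕ} (p : Nat.Partition n) {i : ℕ} (h : i ∈ p.parts) : i ≤ n := by
  have := Multiset.le_sum_of_mem h
  rwa [p.parts_sum] at this

theorem count_mul_le {n : ℕ} (p : Nat.Partition n) (i : ℕ) : p.parts.count i * i ≤ n := by
  have h : Multiset.replicate (p.parts.count i) i ≤ p.parts :=
    Multiset.le_count_iff_replicate_le.mp le_rfl
  obtain ⟨u, hu⟩ := Multiset.le_iff_exists_add.mp h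
  have := congrArg Multiset.sum hu
  rw [p.parts_sum, Multiset.sum_add, Multiset.sum_replicate, smul_eq_mul] at this
  omega

theorem count_zero_part {n : ℕ} (p : Nat.Partition n) : p.parts.count 0 = 0 := by
  rw [Multiset.count_eq_zero]
  intro h
  exact absurd (p.parts_pos h) (by simp)

theorem count_le_n {n : ℕ} (p : Nat.Partition n) (i : ℕ) : p.parts.count i ≤ n := by
  rcases Nat.eq_zero_or_pos i with rfl | hi
  · simp [count_zero_part]
  · exact (Nat.le_mul_of_pos_right _ hi).trans (count_mul_le p i)

theorem cntP_shift (P : Multiset ℕ → Prop) (n c i : ℕ) (hi : 1 ≤ i) :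
    cntP (fun s => c ≤ s.count i ∧ P s) n
      = cntS (fun s => P (s + Multiset.replicate c i)) n (c * i) := by
  classical
  unfold cntS
  split_ifs with h
  · unfold cntP
    symm
    refine Finset.card_bij
      (fun q _ => (⟨q.parts + Multiset.replicate c i, ?_, ?_⟩ : Nat.Partition n)) ?_ ?_ ?_
    · intro j hj
      rw [Multiset.mem_add] at hj
      rcases hj with hj | hj
      · exact q.parts_pos hj
      · rw [Multiset.eq_of_mem_replicate hj]; exact hi
    · rw [Multiset.sum_add, q.parts_sum, Multiset.sum_replicate, smul_eq_mul]; omega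
    · intro q hq
      rw [mem_setP] at hq ⊢
      refine ⟨?_, hq⟩
      simp
    · intro q _ q' _ hqq
      have := congrArg Nat.Partition.parts hqq
      exact Nat.Partition.ext (add_right_cancel this)
    · intro p hp
      rw [mem_setP] at hp
      obtain ⟨u, hu⟩ := Multiset.le_iff_exists_add.mp
        (Multiset.le_count_iff_replicate_le.mp hp.1)
      have hs := congrArg Multiset.sum hu
      rw [p.parts_sum, Multiset.sum_add, Multiset.sum_replicate, smul_eq_mul] at hs
      refine ⟨⟨u, ?_, ?_⟩, ?_, ?_⟩
      · intro j hj
        exact p.parts_pos (by rw [hu]; exact Multiset.mem_add.mpr (Or.inr hj))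
      · omega
      · rw [mem_setP, add_comm, ← hu]; exact hp.2
      · apply Nat.Partition.ext
        simp only
        rw [hu, add_comm]
  · unfold cntP
    rw [Finset.card_eq_zero, Finset.eq_empty_iff_forall_notMem]
    intro p hp
    obtain ⟨hc, -⟩ := mem_setP.mp hp
    exact h ((Nat.mul_le_mul_right i hc).trans (count_mul_le p i))

/-- Splitting a count according to the value of a statistic. -/
theorem cntP_split (P : Multiset ℕ → Prop) (f : Multiset ℕ → ℕ) (n : ℕ) (S : Finset ℕ)
    (hf : ∀ p : Nat.Partition n, P p.parts → f p.parts ∈ S) :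
    cntP P n = ∑ k ∈ S, cntP (fun s => P s ∧ f s = k) n := by
  classical
  unfold cntP
  rw [Finset.card_eq_sum_card_fiberwise (f := fun p : Nat.Partition n => f p.parts) (t := S)]
  · refine Finset.sum_congr rfl fun k _ => ?_
    congr 1
    ext p
    simp [mem_setP]
  · intro p hp
    exact hf p (mem_setP.mp (by simpa using hp))

/-- Double counting. -/
theorem sum_card_filter (P : Multiset ℕ → Prop) (Q : ℕ → Multiset ℕ → Prop) (n : ℕ)
    (S : Finset ℕ) (A : Finset (Nat.Partition n)) (hA : ∀ p, p ∈ A ↔ P p.parts)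
    (f : Nat.Partition n → ℕ)
    (hf : ∀ p ∈ A, ∃ _ : DecidablePred (fun k => Q k p.parts),
      f p = (S.filter fun k => Q k p.parts).card) :
    ∑ p ∈ A, f p = ∑ k ∈ S, cntP (fun s => Q k s ∧ P s) n := by
  classical
  have h1 : ∀ p ∈ A, f p = ∑ k ∈ S, if Q k p.parts then 1 else 0 := by
    intro p hp
    obtain ⟨inst, h⟩ := hf p hp
    rw [h, Finset.card_filter]
    refine Finset.sum_congr rfl fun k _ => ?_
    congr
  rw [Finset.sum_congr rfl h1, Finset.sum_comm]
  refine Finset.sum_congr rfl fun k _ => ?_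
  rw [← Finset.card_filter]
  unfold cntP
  congr 1
  ext p
  simp [mem_setP, hA, and_comm]

def PD (r : ℕ) (s : Multiset ℕ) : Prop := ∀ j, s.count j < r
def PO (r : ℕ) (s : Multiset ℕ) : Prop := ∀ j ∈ s, ¬ r ∣ j
def PF (r i : ℕ) (s : Multiset ℕ) : Prop := ∀ j, j ≠ i → s.count j < r
def PH (r i : ℕ) (s : Multiset ℕ) : Prop := ∀ j ∈ s, r ∣ j → j = i

theorem glaisher (r n : ℕ) (hr : 2 ≤ r) : cntP (PO r) n = cntP (PD r) n := by
  classical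
  have h := Nat.Partition.card_restricted_eq_card_countRestricted n (m := r) (by omega)
  have h1 : cntP (PO r) n = (Nat.Partition.restricted n (¬ r ∣ ·)).card := by
    unfold cntP Nat.Partition.restricted
    congr 1
    ext p
    simp [mem_setP, PO]
  have h2 : cntP (PD r) n = (Nat.Partition.countRestricted n r).card := by
    unfold cntP Nat.Partition.countRestricted
    congr 1
    ext p
    simp only [mem_setP, PD, Finset.mem_filter, Finset.mem_univ, true_and]
    constructor
    · intro h j _; exact h j
    · intro h j
      by_cases hj : j ∈ p.parts
      · exact h j hj
      · rw [Multiset.count_eq_zero.mpr hj]; omega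
  rw [h1, h2, h]

theorem glaisherS (r n m : ℕ) (hr : 2 ≤ r) : cntS (PO r) n m = cntS (PD r) n m := by
  unfold cntS
  rw [glaisher r _ hr]

theorem cntS_congr {P Q : Multiset ℕ → Prop} (h : ∀ s, P s ↔ Q s) (n m : ℕ) :
    cntS P n m = cntS Q n m := by
  have : P = Q := funext fun s => propext (h s)
  rw [this]

theorem cntP_F (r i n N : ℕ) (hr : 2 ≤ r) (hi : 1 ≤ i) (hN : n < N) :
    cntP (PF r i) n = ∑ k ∈ range N, cntS (PD r) n (r * k * i) := by
  rw [cntP_split (PF r i) (fun s => s.count i / r) n (range N)]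
  · refine Finset.sum_congr rfl fun k _ => ?_
    have h1 : cntP (fun s => PF r i s ∧ s.count i / r = k) n
        = cntP (fun s => r * k ≤ s.count i ∧ (PF r i s ∧ s.count i / r = k)) n := by
      refine cntP_congr fun p => ⟨fun h => ⟨?_, h⟩, fun h => h.2⟩
      rw [← h.2]; exact Nat.mul_div_le _ _
    rw [h1, cntP_shift _ _ _ _ hi]
    refine cntS_congr (fun s => ?_) _ _
    simp only [PF, PD, Multiset.count_add, Multiset.count_replicate, if_true]
    rw [Nat.add_mul_div_left _ _ (by omega : 0 < r)]
    constructor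
    · rintro ⟨h, h'⟩ j
      by_cases hj : j = i
      · subst hj
        exact (Nat.div_eq_zero_iff_lt (by omega)).mp (by omega)
      · have := h j hj
        omega
    · intro h
      refine ⟨fun j hj => ?_, ?_⟩
      · have := h j
        rw [if_neg (fun h => hj h.symm)]; omega
      · rw [Nat.div_eq_of_lt (h i)]; omega
  · intro p _
    rw [Finset.mem_range]
    exact ((Nat.div_le_self _ _).trans (count_le_n p i)).trans_lt hN

theorem cntS_F (r i n m : ℕ) (hr : 2 ≤ r) (hi : 1 ≤ i) :
    cntS (PF r i) n m = ∑ k ∈ range (n + 1), cntS (PD r) n (m + r * k * i) := by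
  unfold cntS
  split_ifs with h
  · rw [cntP_F r i (n - m) (n + 1) hr hi (by omega)]
    refine Finset.sum_congr rfl fun k _ => ?_
    unfold cntS
    rw [Nat.sub_sub]
    split_ifs <;> first | rfl | omega
  · symm
    refine Finset.sum_eq_zero fun k _ => if_neg (by omega)

/-- Shifting in `PF`. -/
theorem cntP_F_shift (r i n c : ℕ) (hi : 1 ≤ i) :
    cntP (fun s => c ≤ s.count i ∧ PF r i s) n = cntS (PF r i) n (c * i) := by
  rw [cntP_shift _ _ _ _ hi]
  refine cntS_congr (fun s => ?_) _ _
  simp only [PF, Multiset.count_add, Multiset.count_replicate]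
  refine forall_congr' fun j => forall_congr' fun hj => ?_
  rw [if_neg (fun h => hj h.symm), add_zero]

theorem cntP_O_shift (r i n c : ℕ) (hi : 1 ≤ i) (hri : ¬ r ∣ i) :
    cntP (fun s => c ≤ s.count i ∧ PO r s) n = cntS (PO r) n (c * i) := by
  rw [cntP_shift _ _ _ _ hi]
  refine cntS_congr (fun s => ?_) _ _
  simp only [PO, Multiset.mem_add]
  constructor
  · intro h j hj; exact h j (Or.inl hj)
  · rintro h j (hj | hj)
    · exact h j hj
    · rw [Multiset.eq_of_mem_replicate hj]; exact hri

theorem mem_setO_zero (r n : ℕ) (p : Nat.Partition n) : p ∈ setO 0 r n ↔ PO r p.parts := by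
  simp [setO, PO, Finset.filter_eq_empty_iff]

theorem mem_setD_zero (r n : ℕ) (hr : 2 ≤ r) (p : Nat.Partition n) :
    p ∈ setD 0 r n ↔ PD r p.parts := by
  simp only [setD, PD, Finset.mem_filter, Finset.mem_univ, true_and, Finset.card_eq_zero,
    Finset.filter_eq_empty_iff, Multiset.mem_toFinset, not_le]
  constructor
  · intro h j
    by_cases hj : j ∈ p.parts
    · exact h hj
    · rw [Multiset.count_eq_zero.mpr hj]; omega
  · intro h j _; exact h j

/-- `|D_1|`. -/
theorem card_D_one (r n : ℕ) (hr : 2 ≤ r) :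
    (setD 1 r n).card = ∑ i ∈ Icc 1 n, cntS (PF r i) n (r * i) := by
  have key : ∑ p ∈ setD 1 r n, 1
      = ∑ i ∈ Icc 1 n, cntP (fun s => (r ≤ s.count i ∧ PF r i s) ∧ 
          (∃ i, r ≤ s.count i ∧ PF r i s)) n := by
    refine sum_card_filter (fun s => ∃ i, r ≤ s.count i ∧ PF r i s)
      (fun i s => r ≤ s.count i ∧ PF r i s) n (Icc 1 n) (setD 1 r n) ?_ _ ?_
    · intro p
      simp only [setD, Finset.mem_filter, Finset.mem_univ, true_and, Finset.card_eq_one]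
      refine exists_congr fun i => ?_
      simp only [Finset.ext_iff, Finset.mem_filter, Multiset.mem_toFinset,
        Finset.mem_singleton, PF]
      constructor
      · intro h
        refine ⟨((h i).mpr rfl).2, fun j hj => ?_⟩
        by_contra hc
        have hc' : 0 < p.parts.count j := by omega
        exact hj ((h j).mp ⟨Multiset.count_pos.mp hc', by omega⟩)
      · rintro ⟨h1, h2⟩ j
        constructor
        · rintro ⟨_, h⟩
          by_contra hc
          have := h2 j hc
          omega
        · rintro rfl
          exact ⟨Multiset.count_pos.mp (by omega), h1⟩
    · intro p hp
      classical
      refine ⟨inferInstance, ?_⟩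
      symm
      rw [Finset.card_eq_one]
      simp only [setD, Finset.mem_filter, Finset.mem_univ, true_and, Finset.card_eq_one] at hp
      obtain ⟨i, hi⟩ := hp
      simp only [Finset.ext_iff, Finset.mem_filter, Multiset.mem_toFinset,
        Finset.mem_singleton] at hi
      have hii := (hi i).mpr rfl
      refine ⟨i, ?_⟩
      ext j
      simp only [Finset.mem_filter, Finset.mem_Icc, Finset.mem_singleton]
      constructor
      · rintro ⟨_, h, _⟩
        exact (hi j).mp ⟨Multiset.count_pos.mp (by omega), h⟩
      · rintro rfl
        refine ⟨⟨p.parts_pos hii.1, part_le p hii.1⟩, hii.2, fun k hk => ?_⟩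
        by_contra hc
        exact hk ((hi k).mp ⟨Multiset.count_pos.mp (by omega), by omega⟩)
  rw [Finset.card_eq_sum_ones, key]
  refine Finset.sum_congr rfl fun i hi => ?_
  rw [← cntP_F_shift r i n r (Finset.mem_Icc.mp hi).1]
  exact cntP_congr fun p => ⟨fun h => h.1, fun h => ⟨h, i, h⟩⟩

theorem sum_ellBar (r t n : ℕ) (hr : 2 ≤ r) (ht1 : 1 ≤ t) (ht2 : t ≤ r - 1) :
    ∑ p ∈ setD 0 r n, ellBarMod r t p
      = ∑ i ∈ Icc 1 n, cntP (fun s => t ≤ s.count i ∧ PD r s) n := by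
  refine sum_card_filter (PD r) (fun i s => t ≤ s.count i) n (Icc 1 n) _
    (mem_setD_zero r n hr) _ ?_
  intro p hp
  rw [mem_setD_zero r n hr] at hp
  refine ⟨inferInstance, ?_⟩
  unfold ellBarMod
  congr 1
  ext i
  simp only [Finset.mem_filter, Finset.mem_Icc, Multiset.mem_toFinset]
  rw [Nat.mod_eq_of_lt (hp i)]
  constructor
  · rintro ⟨h1, h2⟩
    exact ⟨⟨p.parts_pos h1, part_le p h1⟩, h2⟩
  · rintro ⟨_, h2⟩
    exact ⟨Multiset.count_pos.mp (by omega), h2⟩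

theorem bar_step (r t n i : ℕ) (ht2 : t ≤ r - 1) (hi : 1 ≤ i) :
    cntP (fun s => t ≤ s.count i ∧ PD r s) n + cntS (PF r i) n (r * i)
      = cntS (PF r i) n (t * i) := by
  classical
  rw [← cntP_F_shift r i n r hi, ← cntP_F_shift r i n t hi]
  unfold cntP
  rw [← Finset.card_union_of_disjoint]
  · congr 1
    ext p
    simp only [Finset.mem_union, mem_setP, PF, PD]
    constructor
    · rintro (⟨h1, h2⟩ | ⟨h1, h2⟩)
      · exact ⟨h1, fun j _ => h2 j⟩
      · exact ⟨by omega, h2⟩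
    · rintro ⟨h1, h2⟩
      by_cases h : r ≤ p.parts.count i
      · exact Or.inr ⟨h, h2⟩
      · refine Or.inl ⟨h1, fun j => ?_⟩
        by_cases hj : j = i
        · subst hj; omega
        · exact h2 j hj
  · rw [Finset.disjoint_left]
    intro p hp hp'
    obtain ⟨_, h⟩ := mem_setP.mp hp
    obtain ⟨h', _⟩ := mem_setP.mp hp'
    have := h i
    omega

theorem sum_ell (r t n : ℕ) (hr : 2 ≤ r) (ht1 : 1 ≤ t) (ht2 : t ≤ r - 1) :
    ∑ p ∈ setO 0 r n, ellMod r t p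
      = ∑ i ∈ Icc 1 n, ∑ k ∈ range (n + 1), cntS (PO r) n (i * (t + r * k)) := by
  have h1 : ∀ p : Nat.Partition n,
      ellMod r t p = ∑ k ∈ range (n + 1), p.parts.count (t + r * k) := by
    intro p
    have hinj : Set.InjOn (fun k => t + r * k) (range (n + 1) : Set ℕ) := by
      intro a _ b _ hab
      have : r * a = r * b := by simpa using hab
      exact Nat.eq_of_mul_eq_mul_left (by omega) this
    have hmod : ∀ k, (t + r * k) % r = t := by
      intro k
      rw [Nat.add_mul_mod_self_left, Nat.mod_eq_of_lt (by omega)]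
    unfold ellMod
    rw [← Finset.sum_image (f := fun j => p.parts.count j) hinj]
    rw [← Multiset.sum_count_eq_card
      (s := (range (n + 1)).image (fun k => t + r * k))]
    · refine Finset.sum_congr rfl fun j hj => ?_
      obtain ⟨k, _, rfl⟩ := Finset.mem_image.mp hj
      rw [Multiset.count_filter_of_pos (p := fun i => i % r = t) (hmod k)]
    · intro j hj
      rw [Multiset.mem_filter] at hj
      have hle := part_le p hj.1
      refine Finset.mem_image.mpr ⟨j / r, ?_, ?_⟩
      · rw [Finset.mem_range]
        have := Nat.div_le_self j r
        omega
      · rw [← hj.2]; exact Nat.mod_add_div j r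
  rw [Finset.sum_congr rfl fun p _ => h1 p, Finset.sum_comm, Finset.sum_comm (s := Icc 1 n)]
  refine Finset.sum_congr rfl fun k _ => ?_
  rw [sum_card_filter (PO r) (fun i s => i ≤ s.count (t + r * k)) n (Icc 1 n) _
    (mem_setO_zero r n)]
  · refine Finset.sum_congr rfl fun i _ => ?_
    refine cntP_O_shift r _ n i (by omega) ?_
    intro hd
    have : r ∣ t := (Nat.dvd_add_left (Dvd.intro k rfl)).mp hd
    have := Nat.le_of_dvd (by omega) this
    omega
  · intro p _
    refine ⟨inferInstance, ?_⟩
    have : (Icc 1 n).filter (fun i => i ≤ p.parts.count (t + r * k))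
        = Icc 1 (p.parts.count (t + r * k)) := by
      ext i
      have := count_le_n p (t + r * k)
      simp only [Finset.mem_filter, Finset.mem_Icc]
      omega
    rw [this]
    simp

theorem sum_ell_zero (r n : ℕ) (p : Nat.Partition n) (hp : p ∈ setO 0 r n) :
    ellMod r 0 p = 0 := by
  rw [mem_setO_zero] at hp
  unfold ellMod
  rw [Multiset.card_eq_zero, Multiset.filter_eq_nil]
  intro j hj h
  exact hp j hj (Nat.dvd_of_mod_eq_zero h)

theorem cntP_H (r i n : ℕ) (hr : 2 ≤ r) (hi : 1 ≤ i) :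
    cntP (fun s => r * i ∈ s ∧ PH r (r * i) s) n
      = ∑ k ∈ range (n + 1), cntS (PO r) n ((k + 1) * (r * i)) := by
  have hri : 1 ≤ r * i := Nat.mul_pos (by omega) hi
  rw [cntP_split _ (fun s => s.count (r * i) - 1) n (range (n + 1))]
  · refine Finset.sum_congr rfl fun k _ => ?_
    have h1 : cntP (fun s => (r * i ∈ s ∧ PH r (r * i) s) ∧ s.count (r * i) - 1 = k) n
        = cntP (fun s => k + 1 ≤ s.count (r * i) ∧
            (PH r (r * i) s ∧ s.count (r * i) = k + 1)) n := by
      refine cntP_congr fun p => ?_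
      rw [← Multiset.count_pos]
      constructor
      · rintro ⟨⟨h1, h2⟩, h3⟩
        exact ⟨by omega, h2, by omega⟩
      · rintro ⟨h1, h2, h3⟩
        exact ⟨⟨by omega, h2⟩, by omega⟩
    rw [h1, cntP_shift _ _ _ _ hri]
    refine cntS_congr (fun s => ?_) _ _
    simp only [PH, PO, Multiset.count_add, Multiset.count_replicate, if_true, Multiset.mem_add]
    constructor
    · rintro ⟨h, h'⟩ j hj hd
      have := h j (Or.inl hj) hd
      subst this
      have := Multiset.count_pos.mpr hj
      omega
    · intro h
      refine ⟨?_, ?_⟩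
      · rintro j (hj | hj) hd
        · exact absurd hd (h j hj)
        · exact Multiset.eq_of_mem_replicate hj
      · have : s.count (r * i) = 0 := Multiset.count_eq_zero.mpr
          fun hm => h _ hm (Dvd.intro i rfl)
        omega
  · intro p _
    rw [Finset.mem_range]
    have := count_le_n p (r * i)
    omega

theorem card_O_one (r n : ℕ) (hr : 2 ≤ r) :
    (setO 1 r n).card
      = ∑ i ∈ Icc 1 n, ∑ k ∈ range (n + 1), cntS (PO r) n ((k + 1) * (r * i)) := by
  have hiff : ∀ (p : Nat.Partition n) (j : ℕ),
      (p.parts.toFinset.filter fun i => r ∣ i) = {j} ↔ (r ∣ j ∧ j ∈ p.parts ∧ PH r j p.parts) := by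
    intro p j
    simp only [Finset.ext_iff, Finset.mem_filter, Multiset.mem_toFinset,
      Finset.mem_singleton, PH]
    constructor
    · intro h
      have := (h j).mpr rfl
      exact ⟨this.2, this.1, fun k hk hd => (h k).mp ⟨hk, hd⟩⟩
    · rintro ⟨h1, h2, h3⟩ k
      constructor
      · rintro ⟨h, h'⟩; exact h3 k h h'
      · rintro rfl; exact ⟨h2, h1⟩
  have hmem : ∀ p : Nat.Partition n,
      p ∈ setO 1 r n ↔ ∃ i, r * i ∈ p.parts ∧ PH r (r * i) p.parts := by
    intro p
    simp only [setO, Finset.mem_filter, Finset.mem_univ, true_and, Finset.card_eq_one, hiff]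
    constructor
    · rintro ⟨_, ⟨i, rfl⟩, h⟩; exact ⟨i, h⟩
    · rintro ⟨i, h⟩; exact ⟨r * i, Dvd.intro i rfl, h⟩
  have key : ∑ p ∈ setO 1 r n, 1
      = ∑ i ∈ Icc 1 n, cntP (fun s => (r * i ∈ s ∧ PH r (r * i) s) ∧
          (∃ i, r * i ∈ s ∧ PH r (r * i) s)) n := by
    refine sum_card_filter (fun s => ∃ i, r * i ∈ s ∧ PH r (r * i) s)
      (fun i s => r * i ∈ s ∧ PH r (r * i) s) n (Icc 1 n) (setO 1 r n) hmem _ ?_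
    intro p hp
    classical
    refine ⟨inferInstance, ?_⟩
    symm
    rw [Finset.card_eq_one]
    obtain ⟨i, hi1, hi2⟩ := (hmem p).mp hp
    refine ⟨i, ?_⟩
    ext j
    simp only [Finset.mem_filter, Finset.mem_Icc, Finset.mem_singleton]
    constructor
    · rintro ⟨_, h, _⟩
      exact Nat.eq_of_mul_eq_mul_left (by omega) (hi2 _ h (Dvd.intro j rfl))
    · rintro rfl
      refine ⟨⟨?_, ?_⟩, hi1, hi2⟩
      · exact Nat.pos_of_mul_pos_left (p.parts_pos hi1)
      · exact (Nat.le_mul_of_pos_left j (by omega)).trans (part_le p hi1)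
  rw [Finset.card_eq_sum_ones, key]
  refine Finset.sum_congr rfl fun i hi => ?_
  rw [← cntP_H r i n hr (Finset.mem_Icc.mp hi).1]
  exact cntP_congr fun p => ⟨fun h => h.1, fun h => ⟨h, i, h⟩⟩

/-- `E_{0,r,t}(n) = |O_{1,r}(n)| = |D_{1,r}(n)|` for `1 ≤ t ≤ r - 1`. -/
theorem EDiff_zero_eq (n r t : ℕ) (hr : 2 ≤ r) (ht1 : 1 ≤ t) (ht2 : t ≤ r - 1) :
    EDiff 0 r t n = ((setO 1 r n).card : ℤ) ∧
      EDiff 0 r t n = ((setD 1 r n).card : ℤ) := by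
  have hOD : (setO 1 r n).card = (setD 1 r n).card := by
    rw [card_O_one r n hr, card_D_one r n hr]
    refine Finset.sum_congr rfl fun i hi => ?_
    rw [cntS_F r i n _ hr (Finset.mem_Icc.mp hi).1]
    refine Finset.sum_congr rfl fun k _ => ?_
    rw [glaisherS r _ _ hr]
    congr 1
    ring
  have hmain : ∑ p ∈ setO 0 r n, ellMod r t p
      = ∑ p ∈ setD 0 r n, ellBarMod r t p + (setD 1 r n).card := by
    rw [sum_ell r t n hr ht1 ht2, sum_ellBar r t n hr ht1 ht2, card_D_one r n hr,
      ← Finset.sum_add_distrib]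
    refine Finset.sum_congr rfl fun i hi => ?_
    have hi1 := (Finset.mem_Icc.mp hi).1
    rw [bar_step r t n i ht2 hi1, cntS_F r i n _ hr hi1]
    refine Finset.sum_congr rfl fun k _ => ?_
    rw [glaisherS r _ _ hr]
    congr 1
    ring
  have hE : EDiff 0 r t n = ((setD 1 r n).card : ℤ) := by
    unfold EDiff
    have h0 : ∑ p ∈ setO 0 r n, ((ellMod r t p : ℤ) - (ellMod r 0 p : ℤ))
        = ((∑ p ∈ setO 0 r n, ellMod r t p : ℕ) : ℤ) := by
      rw [Nat.cast_sum]
      refine Finset.sum_congr rfl fun p hp => ?_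
      rw [sum_ell_zero r n p hp]
      simp
    rw [h0, hmain]
    push_cast
    ring
  exact ⟨by rw [hE, hOD], hE⟩
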